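/- arXiv:0803.3747 — 3 statements merged into one kernel-verified Lean document; each statement's English description precedes it below -/
import Mathlib

section
/- The disconnecting coproduct δ is coassociative and cocommutative, and ε is a counit for it: (δ ⊗ id) ∘ δ = (id ⊗ δ) ∘ δ, (swap of tensor factors) ∘ δ = δ, and (ε ⊗ id) ∘ δ = id = (id ⊗ ε) ∘ δ as linear maps on H. -/
/-! Statement 11: the disconnecting coproduct is coassociative, cocommutative and counital. -/

open MvPolynomial TensorProduct
open scoped Classical

noncomputable section

abbrev H (σ : Type) := MvPolynomial σ ℚ

/-- The counit `ε`: the constant-coefficient map (evaluation of all variables at `0`). -/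
def counitF (σ : Type) : H σ →ₗ[ℚ] ℚ :=
  (aeval (R := ℚ) fun _ : σ => (0 : ℚ)).toLinearMap

/-- The disconnecting coproduct `δ`, defined on the monomial basis by
`δ(∏_{x ∈ supp d} (X x)^{d x}) =
   Σ_{S ⊆ supp d} (∏_{x ∈ S} (X x)^{d x}) ⊗ (∏_{x ∉ S} (X x)^{d x})`:
each full power `(X x)^{d x}` is a single primitive block. -/
def deltaD (σ : Type) : H σ →ₗ[ℚ] (H σ) ⊗[ℚ] (H σ) :=
  (basisMonomials σ ℚ).constr ℚ fun d =>
    ∑ S ∈ d.support.powerset,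
      (monomial (d.filter fun a => a ∈ S) (1 : ℚ)) ⊗ₜ[ℚ]
        (monomial (d.filter fun a => a ∉ S) (1 : ℚ))

theorem deltaD_monomial {σ : Type} (d : σ →₀ ℕ) :
    deltaD σ (monomial d 1) = ∑ S ∈ d.support.powerset,
      (monomial (d.filter fun a => a ∈ S) (1 : ℚ)) ⊗ₜ[ℚ]
        (monomial (d.filter fun a => a ∉ S) (1 : ℚ)) := by
  simpa [deltaD] using (basisMonomials σ ℚ).constr_basis ℚ _ d

theorem counitF_monomial {σ : Type} (d : σ →₀ ℕ) :
    counitF σ (monomial d 1) = if d = 0 then 1 else 0 := by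
  simp [counitF, aeval_zero', constantCoeff_monomial]

theorem counitF_monomial_filter {σ : Type} (d : σ →₀ ℕ) (p : σ → Prop)
    [DecidablePred p] :
    counitF σ (monomial (d.filter p) 1) = if ∀ a ∈ d.support, ¬ p a then 1 else 0 := by
  rw [counitF_monomial]
  congr 1
  simp only [Finsupp.filter_eq_zero_iff, Finsupp.mem_support_iff, eq_iff_iff]
  exact forall_congr' fun a => not_imp_not.symm.trans (by simp)

/-- Two linear maps out of `H σ` agree as soon as they agree on monic monomials. -/
theorem linearMap_ext_monomial {σ : Type} {M : Type*} [AddCommMonoid M] [Module ℚ M]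
    {f g : H σ →ₗ[ℚ] M} (h : ∀ d, f (monomial d 1) = g (monomial d 1)) : f = g :=
  (basisMonomials σ ℚ).ext fun d => by simpa using h d

theorem deltaD_coassoc (σ : Type) :
    (TensorProduct.assoc ℚ (H σ) (H σ) (H σ)).toLinearMap ∘ₗ
        LinearMap.rTensor (H σ) (deltaD σ) ∘ₗ deltaD σ =
      LinearMap.lTensor (H σ) (deltaD σ) ∘ₗ deltaD σ := by
  refine linearMap_ext_monomial fun d => ?_
  simp only [LinearMap.comp_apply, deltaD_monomial, map_sum, LinearMap.rTensor_tmul,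
    LinearMap.lTensor_tmul, TensorProduct.sum_tmul, TensorProduct.tmul_sum,
    LinearEquiv.coe_coe, TensorProduct.assoc_tmul]
  rw [Finset.sum_sigma', Finset.sum_sigma']
  refine Finset.sum_bij' (fun x _ => ⟨x.2, x.1 \ x.2⟩) (fun x _ => ⟨x.1 ∪ x.2, x.1⟩)
    ?_ ?_ ?_ ?_ ?_
  all_goals
    rintro ⟨S, T⟩ h
    simp only [Finset.mem_sigma, Finset.mem_powerset, Finset.subset_iff,
      Finsupp.support_filter, Finset.mem_filter] at h
  · simp only [Finset.mem_sigma, Finset.mem_powerset, Finset.subset_iff,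
      Finsupp.support_filter, Finset.mem_filter, Finset.mem_sdiff]
    grind
  · simp only [Finset.mem_sigma, Finset.mem_powerset, Finset.subset_iff,
      Finsupp.support_filter, Finset.mem_filter, Finset.mem_union]
    grind
  · have : T ∪ S \ T = S := by grind
    simp [this]
  · have : (S ∪ T) \ S = T := by grind
    simp [this]
  · refine congr_arg₂ _ ?_ (congr_arg₂ _ ?_ ?_)
    all_goals
      refine congrArg (monomial · (1 : ℚ)) (Finsupp.ext fun a => ?_)
      simp only [Finsupp.filter_apply, Finset.mem_sdiff]
      grind

theorem deltaD_cocomm (σ : Type) :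
    (TensorProduct.comm ℚ (H σ) (H σ)).toLinearMap ∘ₗ deltaD σ = deltaD σ := by
  refine linearMap_ext_monomial fun d => ?_
  simp only [LinearMap.comp_apply, deltaD_monomial, map_sum, LinearEquiv.coe_coe,
    TensorProduct.comm_tmul]
  refine Finset.sum_bij' (fun S _ => d.support \ S) (fun S _ => d.support \ S)
    (by simp) (by simp) ?_ ?_ ?_
  · intro S hS
    exact Finset.sdiff_sdiff_eq_self (Finset.mem_powerset.mp hS)
  · intro S hS
    exact Finset.sdiff_sdiff_eq_self (Finset.mem_powerset.mp hS)
  · intro S hS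
    refine congr_arg₂ _ ?_ ?_
    all_goals
      refine congrArg (monomial · (1 : ℚ)) (Finsupp.ext fun a => ?_)
      simp only [Finsupp.filter_apply, Finset.mem_sdiff, Finsupp.mem_support_iff]
      grind

theorem deltaD_lid (σ : Type) :
    (TensorProduct.lid ℚ (H σ)).toLinearMap ∘ₗ
        LinearMap.rTensor (H σ) (counitF σ) ∘ₗ deltaD σ = LinearMap.id := by
  refine linearMap_ext_monomial fun d => ?_
  simp only [LinearMap.comp_apply, deltaD_monomial, map_sum, LinearEquiv.coe_coe,
    LinearMap.rTensor_tmul, TensorProduct.lid_tmul, counitF_monomial_filter, LinearMap.id_apply]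
  rw [Finset.sum_eq_single ∅]
  · simp [Finsupp.filter_eq_self_iff]
  · intro S hS hne
    obtain ⟨a, ha⟩ := Finset.nonempty_iff_ne_empty.mpr hne
    rw [if_neg fun h => h a (Finset.mem_powerset.mp hS ha) ha, zero_smul]
  · simp

theorem deltaD_rid (σ : Type) :
    (TensorProduct.rid ℚ (H σ)).toLinearMap ∘ₗ
        LinearMap.lTensor (H σ) (counitF σ) ∘ₗ deltaD σ = LinearMap.id := by
  have h : (TensorProduct.rid ℚ (H σ)).toLinearMap ∘ₗ LinearMap.lTensor (H σ) (counitF σ) =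
      (TensorProduct.lid ℚ (H σ)).toLinearMap ∘ₗ LinearMap.rTensor (H σ) (counitF σ) ∘ₗ
        (TensorProduct.comm ℚ (H σ) (H σ)).toLinearMap :=
    TensorProduct.ext' fun x y => by simp
  rw [← LinearMap.comp_assoc, h, LinearMap.comp_assoc, LinearMap.comp_assoc, deltaD_cocomm,
    deltaD_lid]

/-- The disconnecting coproduct `δ` is coassociative and cocommutative, and
`ε` is a counit for it: `(δ ⊗ id) ∘ δ = (id ⊗ δ) ∘ δ` (up to the associator),
`swap ∘ δ = δ`, and `(ε ⊗ id) ∘ δ = id = (id ⊗ ε) ∘ δ`. -/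
theorem stmt11 (σ : Type) :
    ((TensorProduct.assoc ℚ (H σ) (H σ) (H σ)).toLinearMap ∘ₗ
        LinearMap.rTensor (H σ) (deltaD σ) ∘ₗ deltaD σ =
      LinearMap.lTensor (H σ) (deltaD σ) ∘ₗ deltaD σ) ∧
    ((TensorProduct.comm ℚ (H σ) (H σ)).toLinearMap ∘ₗ deltaD σ = deltaD σ) ∧
    ((TensorProduct.lid ℚ (H σ)).toLinearMap ∘ₗ
        LinearMap.rTensor (H σ) (counitF σ) ∘ₗ deltaD σ = LinearMap.id) ∧
    ((TensorProduct.rid ℚ (H σ)).toLinearMap ∘ₗ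
        LinearMap.lTensor (H σ) (counitF σ) ∘ₗ deltaD σ = LinearMap.id) := by
  exact ⟨deltaD_coassoc σ, deltaD_cocomm σ, deltaD_lid σ, deltaD_rid σ⟩

end
end

section
/- For every P ∈ MvPolynomial ℕ ℚ and all h, h' ∈ H one has β(P)(h·h') = Σ β(P₍₁₎)(h) · β(P₍₂₎)(h'), where ΔP = Σ P₍₁₎ ⊗ P₍₂₎ is the coproduct of P; that is, the universal algebra map β intertwines the coalgebra structure of qSym with the action of products in H. -/
/-! Statement 17: the universal map β intertwines the coproduct with products. -/

open MvPolynomial TensorProduct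

noncomputable section

/-- The coproduct on `MvPolynomial ℕ ℚ` (the model of `qSym`): the algebra map
with all `X m` primitive. -/
def DeltaQ : MvPolynomial ℕ ℚ →ₐ[ℚ] (MvPolynomial ℕ ℚ) ⊗[ℚ] (MvPolynomial ℕ ℚ) :=
  aeval fun m : ℕ => X m ⊗ₜ[ℚ] 1 + 1 ⊗ₜ[ℚ] X m

/-- Right multiplication by a primitive element `X n` becomes the Leibniz rule under
`p ⊗ q ↦ β p h * β q h'`. -/
theorem lift_mul_compl₁₂_mul_primitive {H : Type*} [CommRing H] [Algebra ℚ H]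
    (β : MvPolynomial ℕ ℚ →ₐ[ℚ] Module.End ℚ H) (n : ℕ) (h h' : H)
    (t : MvPolynomial ℕ ℚ ⊗[ℚ] MvPolynomial ℕ ℚ) :
    TensorProduct.lift ((LinearMap.mul ℚ H).compl₁₂
          ((LinearMap.applyₗ h).comp β.toLinearMap)
          ((LinearMap.applyₗ h').comp β.toLinearMap))
        (t * (X n ⊗ₜ[ℚ] 1 + 1 ⊗ₜ[ℚ] X n)) =
      TensorProduct.lift ((LinearMap.mul ℚ H).compl₁₂
          ((LinearMap.applyₗ (β (X n) h)).comp β.toLinearMap)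
          ((LinearMap.applyₗ h').comp β.toLinearMap)) t +
      TensorProduct.lift ((LinearMap.mul ℚ H).compl₁₂
          ((LinearMap.applyₗ h).comp β.toLinearMap)
          ((LinearMap.applyₗ (β (X n) h')).comp β.toLinearMap)) t := by
  induction t with
  | zero => simp
  | tmul p q => simp [mul_add]
  | add s t hs ht => rw [add_mul, map_add, hs, ht, map_add, map_add]; abel

/-- Proposition 6.3: let `H` be a commutative ℚ-algebra, `A : ℕ → Der(H)` a
family of pairwise commuting derivations, and `β : MvPolynomial ℕ ℚ → End(H)`
the (universal) algebra map with `β(X n) = A n`.  Then for every `P` and all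
`h, h' ∈ H`, `β(P)(h·h') = Σ β(P₍₁₎)(h) · β(P₍₂₎)(h')`, where
`ΔP = Σ P₍₁₎ ⊗ P₍₂₎`; the Sweedler sum is the lift of the bilinear map
`(p, q) ↦ β(p)(h) · β(q)(h')` applied to `ΔP`. -/
theorem stmt17 (H : Type) [CommRing H] [Algebra ℚ H]
    (A : ℕ → Derivation ℚ H H)
    (hA : ∀ m n : ℕ, (A m).toLinearMap ∘ₗ (A n).toLinearMap
        = (A n).toLinearMap ∘ₗ (A m).toLinearMap)
    (β : MvPolynomial ℕ ℚ →ₐ[ℚ] Module.End ℚ H)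
    (hβ : ∀ n : ℕ, β (X n) = (A n).toLinearMap)
    (P : MvPolynomial ℕ ℚ) (h h' : H) :
    β P (h * h') =
      TensorProduct.lift ((LinearMap.mul ℚ H).compl₁₂
          ((LinearMap.applyₗ h).comp β.toLinearMap)
          ((LinearMap.applyₗ h').comp β.toLinearMap))
        (DeltaQ P) := by
  induction P using MvPolynomial.induction_on generalizing h h' with
  | C a => simp [← algebraMap_eq, Algebra.TensorProduct.algebraMap_apply]
  | add p q hp hq => simp only [map_add, LinearMap.add_apply, hp, hq]
  | mul_X p n ih =>
    have hX : DeltaQ (X n) = X n ⊗ₜ[ℚ] 1 + 1 ⊗ₜ[ℚ] X n := aeval_X _ n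
    have leibniz : β (X n) (h * h') = β (X n) h * h' + h * β (X n) h' := by
      simp [hβ, mul_comm, add_comm]
    rw [map_mul DeltaQ, hX, lift_mul_compl₁₂_mul_primitive, ← ih, ← ih, map_mul β,
      Module.End.mul_apply, leibniz, map_add]

end
end

section
/- Define Lₙᵏ := β(𝐒ₙᵏ) ∈ Module.End ℚ H. Then for all natural numbers n and all k ≥ 1, the operators Lₙᵏ satisfy the recursion Lₙᵏ = (1/k) · Σ_{m=0}^{n} L_{n−m}^{k−1} ∘ (A m) (a generalization of Mestre and Oeckl's recursion, which is the special case where A m = 0 for m ∉ {0,1}). -/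
/-! Statement 19: the recursion for the operators Lₙᵏ = β(𝐒ₙᵏ). -/

open MvPolynomial TensorProduct

noncomputable section

/-- `𝐒ₙᵏ = Σ_α ∏_{i=0}^{n} (X i)^{αᵢ}/αᵢ!`, summed over all `(n+1)`-tuples
`α` of nonnegative integers with `α₀ + ⋯ + αₙ = k` and
`α₁ + 2α₂ + ⋯ + nαₙ = n` (such tuples satisfy `αᵢ ≤ k`, whence the finite
index set below). -/
def Sc (n k : ℕ) : MvPolynomial ℕ ℚ :=
  ∑ α ∈ (Fintype.piFinset fun _ : Fin (n + 1) => Finset.range (k + 1)).filter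
      (fun α => (∑ i : Fin (n + 1), α i) = k ∧ (∑ i : Fin (n + 1), (i : ℕ) * α i) = n),
    (∏ i : Fin (n + 1), ((α i).factorial : ℚ)⁻¹) •
      ∏ i : Fin (n + 1), (X (i : ℕ) : MvPolynomial ℕ ℚ) ^ (α i)

/-- The generating power series `∑ i, X i * t ^ i`. -/
def genSeries : PowerSeries (MvPolynomial ℕ ℚ) := PowerSeries.mk X

lemma trunc_genSeries (n : ℕ) :
    PowerSeries.trunc (n + 1) genSeries =
      ∑ i : Fin (n + 1), Polynomial.monomial (i : ℕ) (X (i : ℕ) : MvPolynomial ℕ ℚ) := by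
  rw [Fin.sum_univ_eq_sum_range
    (fun i => Polynomial.monomial i (X i : MvPolynomial ℕ ℚ)) (n + 1)]
  ext1 m
  simp [PowerSeries.coeff_trunc, Polynomial.finsetSum_coeff, Polynomial.coeff_monomial, genSeries]

lemma coeff_genSeries_pow (n k : ℕ) :
    PowerSeries.coeff n (genSeries ^ k) =
      ((∑ i : Fin (n + 1), Polynomial.monomial (i : ℕ) (X (i : ℕ) : MvPolynomial ℕ ℚ)) ^ k).coeff
        n := by
  have h := congrArg (fun p => Polynomial.coeff p n)
    (PowerSeries.trunc_trunc_pow genSeries (n + 1) k)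
  simp only [PowerSeries.coeff_trunc, Nat.lt_succ_self, if_true] at h
  rw [← h, trunc_genSeries, ← Polynomial.coe_pow, Polynomial.coeff_coe]

lemma prod_monomial_pow {R ι : Type*} [CommSemiring R] (s : Finset ι) (d a : ι → ℕ) (r : ι → R) :
    ∏ i ∈ s, Polynomial.monomial (d i) (r i) ^ a i =
      Polynomial.monomial (∑ i ∈ s, d i * a i) (∏ i ∈ s, r i ^ a i) := by
  classical
  induction s using Finset.induction_on with
  | empty => simp
  | insert i s hi ih =>
    rw [Finset.prod_insert hi, Finset.prod_insert hi, Finset.sum_insert hi, ih,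
      Polynomial.monomial_pow, Polynomial.monomial_mul_monomial]

lemma filter_piFinset_range_eq (n k : ℕ) :
    (Fintype.piFinset fun _ : Fin (n + 1) => Finset.range (k + 1)).filter
      (fun α => (∑ i : Fin (n + 1), α i) = k ∧ (∑ i : Fin (n + 1), (i : ℕ) * α i) = n) =
    (Finset.piAntidiag Finset.univ k).filter
      (fun α : Fin (n + 1) → ℕ => (∑ i : Fin (n + 1), (i : ℕ) * α i) = n) := by
  ext α
  simp only [Finset.mem_filter, Fintype.mem_piFinset, Finset.mem_range, Finset.mem_piAntidiag,
    Finset.mem_univ, implies_true, and_true]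
  refine ⟨fun h => h.2, fun h => ⟨fun i => ?_, h⟩⟩
  exact Nat.lt_succ_of_le <|
    (Finset.single_le_sum (fun _ _ => Nat.zero_le _) (Finset.mem_univ i)).trans_eq h.1

/-- `𝐒ₙᵏ` is the coefficient of `t ^ n` in the `k`-th divided power of the generating series. -/
lemma factorial_smul_Sc (n k : ℕ) :
    (k.factorial : ℚ) • Sc n k = PowerSeries.coeff n (genSeries ^ k) := by
  rw [coeff_genSeries_pow, Finset.sum_pow_eq_sum_piAntidiag, Polynomial.finsetSum_coeff, Sc,
    filter_piFinset_range_eq, Finset.sum_filter, Finset.smul_sum]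
  refine Finset.sum_congr rfl fun α hα => ?_
  rw [prod_monomial_pow, Polynomial.coeff_natCast_mul, Polynomial.coeff_monomial]
  split_ifs with h
  · have hs := Nat.multinomial_spec Finset.univ α
    rw [(Finset.mem_piAntidiag.mp hα).1] at hs
    have hc : (k.factorial : ℚ) * ∏ i, ((α i).factorial : ℚ)⁻¹ =
        Nat.multinomial Finset.univ α := by
      rw [← hs, Finset.prod_inv_distrib]
      push_cast
      have : ∏ i, ((α i).factorial : ℚ) ≠ 0 :=
        Finset.prod_ne_zero_iff.mpr fun i _ => by positivity
      field_simp
    rw [smul_smul, hc, Nat.cast_smul_eq_nsmul, nsmul_eq_mul]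
  · simp

lemma Sc_succ (n k : ℕ) :
    Sc n (k + 1) = ((k + 1 : ℕ) : ℚ)⁻¹ • ∑ m ∈ Finset.range (n + 1), Sc (n - m) k * X m := by
  have hk : ((k + 1).factorial : ℚ) ≠ 0 := by positivity
  apply smul_right_injective _ hk
  have hf : ((k + 1).factorial : ℚ) * ((k + 1 : ℕ) : ℚ)⁻¹ = k.factorial := by
    rw [Nat.factorial_succ]
    push_cast
    field_simp
  simp only
  rw [smul_smul, hf, factorial_smul_Sc, pow_succ', PowerSeries.coeff_mul,
    Finset.Nat.sum_antidiagonal_eq_sum_range_succ_mk, Finset.smul_sum]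
  refine Finset.sum_congr rfl fun m _ => ?_
  rw [← smul_mul_assoc, factorial_smul_Sc, mul_comm]
  simp [genSeries]

/-- With `H` a commutative ℚ-algebra, `A : ℕ → Der(H)` pairwise commuting
derivations and `β` the universal algebra map with `β(X n) = A n`, define
`Lₙᵏ := β(𝐒ₙᵏ)`.  Then for all `n` and all `k ≥ 1`:
`Lₙᵏ = (1/k) Σ_{m=0}^{n} L_{n-m}^{k-1} ∘ Aₘ` (generalizing Mestre–Oeckl,
which is the case `A m = 0` for `m ∉ {0,1}`). -/
theorem stmt19 (H : Type) [CommRing H] [Algebra ℚ H]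
    (A : ℕ → Derivation ℚ H H)
    (hA : ∀ m n : ℕ, (A m).toLinearMap ∘ₗ (A n).toLinearMap
        = (A n).toLinearMap ∘ₗ (A m).toLinearMap)
    (β : MvPolynomial ℕ ℚ →ₐ[ℚ] Module.End ℚ H)
    (hβ : ∀ n : ℕ, β (X n) = (A n).toLinearMap)
    (n k : ℕ) (hk : 1 ≤ k) :
    β (Sc n k) =
      ((k : ℚ))⁻¹ • ∑ m ∈ Finset.range (n + 1),
        β (Sc (n - m) (k - 1)) ∘ₗ (A m).toLinearMap := by
  obtain ⟨k, rfl⟩ := Nat.exists_eq_add_of_le' hk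
  rw [Sc_succ, map_smul, map_sum, Nat.add_sub_cancel]
  simp only [map_mul, hβ, Module.End.mul_eq_comp]

end
end
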